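/- arXiv:1901.00571 — 6 statements merged into one kernel-verified Lean document; each statement's English description precedes it below -/
import Mathlib

section
/- Let n ≥ 1, let A : ℝ → Matrix (Fin n) (Fin n) ℝ and M : ℝ → Matrix (Fin n) (Fin n) ℝ, and let t₀ ∈ ℝ. If M has derivative A(t₀) * M(t₀) at t₀ (i.e. HasDerivAt M (A(t₀) * M(t₀)) t₀, entrywise), then the function t ↦ det(M(t)) has derivative trace(A(t₀)) · det(M(t₀)) at t₀ (Liouville's formula for linear matrix differential equations; this is the algebraic core of Proposition 1.2 ii). -/
/-- **Liouville's formula** (algebraic core of Proposition 1.2 ii):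
if the matrix curve `M` solves `M' = A(t₀) * M` at `t₀` (entrywise), then
`t ↦ det (M t)` has derivative `trace (A t₀) * det (M t₀)` at `t₀`. -/
theorem liouville_det_deriv (n : ℕ) (hn : 1 ≤ n)
    (A M : ℝ → Matrix (Fin n) (Fin n) ℝ) (t₀ : ℝ)
    (hM : ∀ i j : Fin n, HasDerivAt (fun t => M t i j) ((A t₀ * M t₀) i j) t₀) :
    HasDerivAt (fun t => (M t).det) ((A t₀).trace * (M t₀).det) t₀ := by
  have h1 : ∀ i, ((M t₀).updateRow i ((A t₀ * M t₀) i)).det = A t₀ i i * (M t₀).det := by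
    intro i
    have h := Matrix.det_updateRow_sum (M t₀) i (A t₀ i)
    rw [smul_eq_mul] at h
    rw [← h]
    congr 2
    ext j
    simp [Matrix.mul_apply, Finset.sum_apply]
  have h2 : (A t₀).trace * (M t₀).det
      = ∑ σ : Equiv.Perm (Fin n), ((Equiv.Perm.sign σ : ℤ) : ℝ) *
        ∑ i, (∏ j ∈ Finset.univ.erase i, M t₀ j (σ j)) • (A t₀ * M t₀) i (σ i) := by
    simp only [Matrix.trace, Matrix.diag, Finset.sum_mul, ← h1, Finset.mul_sum]
    rw [Finset.sum_comm]
    refine Finset.sum_congr rfl fun i _ => ?_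
    rw [← Matrix.det_transpose, Matrix.det_apply']
    refine Finset.sum_congr rfl fun σ _ => ?_
    rw [← Finset.prod_erase_mul _ _ (Finset.mem_univ i)]
    simp only [Matrix.transpose_apply, Matrix.updateRow_self, smul_eq_mul]
    congr 2
    refine Finset.prod_congr rfl fun j hj => ?_
    rw [Matrix.updateRow_ne (Finset.ne_of_mem_erase hj)]
  have h3 : (fun t => (M t).det) = fun t => ∑ σ : Equiv.Perm (Fin n),
      ((Equiv.Perm.sign σ : ℤ) : ℝ) * ∏ i, M t i (σ i) := by
    funext t
    rw [← Matrix.det_transpose, Matrix.det_apply']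
    rfl
  rw [h2, h3]
  exact HasDerivAt.fun_sum fun σ _ =>
    (HasDerivAt.fun_finsetProd fun i _ => hM i (σ i)).const_mul _
end

section
/- Let D ⊂ ℝ² be open and convex in the t-direction, let h ∈ ℝ, let H = (H₁,H₂) : ℝ² → ℝ² be continuously differentiable with H₂(x) > 0 for all x, and let X : D → ℝ² be twice continuously differentiable with ∂X/∂t(t,w) = H(X(t,w)) for all (t,w) ∈ D, and X(0,w) = (w,h) whenever (0,w) ∈ D. Define Y(t,w) = det[∂X/∂t(t,w), ∂X/∂w(t,w)]. Then for every (t,w) ∈ D with (0,w) ∈ D one has Y(t,w) = −H₂(w,h) · exp(∫₀ᵗ div H(X(s,w)) ds); in particular Y(t,w) < 0, so the Jacobian determinant of the map (t,w) ↦ X(t,w) never vanishes (Proposition 1.2 iii). -/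
/-- Divergence of a planar vector field `H = (H₁, H₂)`:
`div H = ∂H₁/∂x₁ + ∂H₂/∂x₂`. -/
noncomputable def planarDiv (H : ℝ × ℝ → ℝ × ℝ) (x : ℝ × ℝ) : ℝ :=
  (fderiv ℝ H x (1, 0)).1 + (fderiv ℝ H x (0, 1)).2

/-- The Jacobian determinant `Y(t,w) = det[∂X/∂t, ∂X/∂w]` of a map `X` satisfying
`∂X/∂t = H ∘ X`, i.e. `Y(t,w) = H₁(X(t,w))·∂X₂/∂w(t,w) − H₂(X(t,w))·∂X₁/∂w(t,w)`. -/
noncomputable def jacY (H : ℝ × ℝ → ℝ × ℝ) (X : ℝ × ℝ → ℝ × ℝ) (p : ℝ × ℝ) : ℝ :=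
  (H (X p)).1 * (fderiv ℝ X p (0, 1)).2 - (H (X p)).2 * (fderiv ℝ X p (0, 1)).1

theorem aux_tr (M : ℝ × ℝ →L[ℝ] ℝ × ℝ) (a v : ℝ × ℝ) :
    (M a).1 * v.2 + a.1 * (M v).2 - ((M a).2 * v.1 + a.2 * (M v).1)
      = ((M (1, 0)).1 + (M (0, 1)).2) * (a.1 * v.2 - a.2 * v.1) := by
  have key : ∀ u : ℝ × ℝ, M u = u.1 • M (1, 0) + u.2 • M (0, 1) := by
    intro u
    rw [← map_smul, ← map_smul, ← map_add]
    congr 1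
    ext <;> simp
  rw [key a, key v]
  simp only [Prod.fst_add, Prod.snd_add, Prod.smul_fst, Prod.smul_snd, smul_eq_mul]
  ring

theorem aux_deriv (D : Set (ℝ × ℝ)) (hD : IsOpen D)
    (H : ℝ × ℝ → ℝ × ℝ) (hH : ContDiff ℝ 1 H)
    (X : ℝ × ℝ → ℝ × ℝ) (hX : ContDiffOn ℝ 2 X D)
    (hflow : ∀ p ∈ D, fderiv ℝ X p (1, 0) = H (X p)) (s w : ℝ) (hs : (s, w) ∈ D) :
    HasDerivAt (fun s => jacY H X (s, w))
      (planarDiv H (X (s, w)) * jacY H X (s, w)) s := by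
  have hXat : ContDiffAt ℝ 2 X (s, w) := hX.contDiffAt (hD.mem_nhds hs)
  have hXd : HasFDerivAt X (fderiv ℝ X (s, w)) (s, w) :=
    (hXat.differentiableAt (by norm_num)).hasFDerivAt
  have hHd : HasFDerivAt H (fderiv ℝ H (X (s, w))) (X (s, w)) :=
    ((hH.differentiable (by norm_num)) _).hasFDerivAt
  have hF : ContDiffAt ℝ 1 (fderiv ℝ X) (s, w) :=
    hXat.fderiv_right (by norm_num)
  have hFd : HasFDerivAt (fderiv ℝ X) (fderiv ℝ (fderiv ℝ X) (s, w)) (s, w) :=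
    (hF.differentiableAt (by norm_num)).hasFDerivAt
  have hsymm : IsSymmSndFDerivAt ℝ X (s, w) :=
    hXat.isSymmSndFDerivAt (by simp)
  have hline : HasDerivAt (fun s : ℝ => ((s, w) : ℝ × ℝ)) (1, 0) s :=
    (hasDerivAt_id s).prodMk (hasDerivAt_const s w)
  have hHX : HasFDerivAt (fun q => H (X q)) _ (s, w) := hHd.comp (s, w) hXd
  have h1 : HasDerivAt (fun s => H (X (s, w))) (fderiv ℝ H (X (s, w)) (H (X (s, w)))) s := by
    have := hHX.comp_hasDerivAt s hline
    rw [ContinuousLinearMap.comp_apply, hflow _ hs] at this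
    exact this
  have h2 : HasDerivAt (fun s => fderiv ℝ X (s, w) (0, 1))
      (fderiv ℝ H (X (s, w)) (fderiv ℝ X (s, w) (0, 1))) s := by
    have e1 : HasFDerivAt (fun q => fderiv ℝ X q (1, 0))
        ((fderiv ℝ H (X (s, w))).comp (fderiv ℝ X (s, w))) (s, w) := by
      refine hHX.congr_of_eventuallyEq ?_
      filter_upwards [hD.mem_nhds hs] with q hq using hflow q hq
    have e2 : HasFDerivAt (fun q => fderiv ℝ X q (1, 0)) _ (s, w) :=
      (ContinuousLinearMap.apply ℝ (ℝ × ℝ) ((1, 0) : ℝ × ℝ)).hasFDerivAt.comp (s, w) hFd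
    have e3 : fderiv ℝ H (X (s, w)) (fderiv ℝ X (s, w) (0, 1))
        = fderiv ℝ (fderiv ℝ X) (s, w) (0, 1) (1, 0) :=
      congrArg (fun L : ℝ × ℝ →L[ℝ] ℝ × ℝ => L ((0, 1) : ℝ × ℝ)) (e1.unique e2)
    have e4 := (ContinuousLinearMap.apply ℝ (ℝ × ℝ) ((0, 1) : ℝ × ℝ)).hasFDerivAt.comp_hasDerivAt
      s (hFd.comp_hasDerivAt s hline)
    rw [e3, hsymm.eq]
    exact e4
  have hfst : ∀ {f : ℝ → ℝ × ℝ} {f' : ℝ × ℝ}, HasDerivAt f f' s →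
      HasDerivAt (fun r => (f r).1) f'.1 s := fun hf =>
    (ContinuousLinearMap.fst ℝ ℝ ℝ).hasFDerivAt.comp_hasDerivAt s hf
  have hsnd : ∀ {f : ℝ → ℝ × ℝ} {f' : ℝ × ℝ}, HasDerivAt f f' s →
      HasDerivAt (fun r => (f r).2) f'.2 s := fun hf =>
    (ContinuousLinearMap.snd ℝ ℝ ℝ).hasFDerivAt.comp_hasDerivAt s hf
  have h3 := ((hfst h1).fun_mul (hsnd h2)).fun_sub ((hsnd h1).fun_mul (hfst h2))
  have := aux_tr (fderiv ℝ H (X (s, w))) (H (X (s, w))) (fderiv ℝ X (s, w) (0, 1))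
  unfold planarDiv jacY
  rw [← this]
  exact h3

/-- **Proposition 1.2 iii)**:
`Y(t,w) = −H₂(w,h) · exp (∫₀ᵗ div H (X(s,w)) ds)`, and in particular `Y(t,w) < 0`. -/
theorem jacobian_formula (D : Set (ℝ × ℝ)) (hD : IsOpen D)
    (hDconv : ∀ w t₀ t₁ t : ℝ, (t₀, w) ∈ D → (t₁, w) ∈ D → t ∈ Set.uIcc t₀ t₁ → (t, w) ∈ D)
    (h : ℝ)
    (H : ℝ × ℝ → ℝ × ℝ) (hH : ContDiff ℝ 1 H) (hH2 : ∀ x, 0 < (H x).2)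
    (X : ℝ × ℝ → ℝ × ℝ) (hX : ContDiffOn ℝ 2 X D)
    (hflow : ∀ p ∈ D, fderiv ℝ X p (1, 0) = H (X p))
    (hX0 : ∀ w : ℝ, (0, w) ∈ D → X (0, w) = (w, h)) :
    ∀ t w : ℝ, (t, w) ∈ D → (0, w) ∈ D →
      jacY H X (t, w) = -(H (w, h)).2 * Real.exp (∫ s in (0:ℝ)..t, planarDiv H (X (s, w)))
        ∧ jacY H X (t, w) < 0 := by
  intro t w ht h0
  set U : Set ℝ := {s | (s, w) ∈ D} with hU
  have hcl : Continuous (fun s : ℝ => ((s, w) : ℝ × ℝ)) := by fun_prop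
  have hUo : IsOpen U := hD.preimage hcl
  have hUc : U.OrdConnected := Set.ordConnected_iff_uIcc_subset.2
    (fun x hx y hy z hz => hDconv w x y z hx hy hz)
  have hdc : Continuous (planarDiv H) := by
    have := hH.continuous_fderiv (by norm_num)
    unfold planarDiv
    fun_prop
  have hgc : ContinuousOn (fun s => planarDiv H (X (s, w))) U :=
    hdc.comp_continuousOn (hX.continuousOn.comp hcl.continuousOn (fun s hs => hs))
  have hI : ∀ s ∈ U, HasDerivAt (fun s => ∫ r in (0:ℝ)..s, planarDiv H (X (r, w)))
      (planarDiv H (X (s, w))) s := by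
    intro s hs
    refine intervalIntegral.integral_hasDerivAt_right
      (hgc.mono (hUc.uIcc_subset h0 hs)).intervalIntegrable
      (hgc.stronglyMeasurableAtFilter hUo s hs) (hgc.continuousAt (hUo.mem_nhds hs))
  have hZ : ∀ s ∈ U, HasDerivAt (fun s => jacY H X (s, w) *
      Real.exp (-∫ r in (0:ℝ)..s, planarDiv H (X (r, w)))) 0 s := by
    intro s hs
    have := (aux_deriv D hD H hH X hX hflow s w hs).fun_mul (hI s hs).fun_neg.exp
    exact this.congr_deriv (by ring)
  have hconst := hUo.is_const_of_deriv_eq_zero hUc.isPreconnected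
    (fun s hs => (hZ s hs).differentiableAt.differentiableWithinAt)
    (fun s hs => (hZ s hs).deriv) ht h0
  have hV : fderiv ℝ X (0, w) (0, 1) = (1, 0) := by
    have hXd : HasFDerivAt X (fderiv ℝ X (0, w)) (0, w) :=
      ((hX.contDiffAt (hD.mem_nhds h0)).differentiableAt (by norm_num)).hasFDerivAt
    have hline : HasDerivAt (fun v : ℝ => ((0, v) : ℝ × ℝ)) (0, 1) w :=
      (hasDerivAt_const w (0:ℝ)).prodMk (hasDerivAt_id w)
    have e1 := hXd.comp_hasDerivAt w hline
    have e2 : HasDerivAt (fun v : ℝ => ((v, h) : ℝ × ℝ)) (1, 0) w :=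
      (hasDerivAt_id w).prodMk (hasDerivAt_const w h)
    refine e1.unique (e2.congr_of_eventuallyEq ?_)
    have hc : Continuous (fun v : ℝ => ((0, v) : ℝ × ℝ)) := by fun_prop
    filter_upwards [(hD.preimage hc).mem_nhds h0] with v hv using hX0 v hv
  have hY0 : jacY H X (0, w) = -(H (w, h)).2 := by
    unfold jacY
    rw [hV, hX0 w h0]
    simp
  have main : jacY H X (t, w) =
      -(H (w, h)).2 * Real.exp (∫ s in (0:ℝ)..t, planarDiv H (X (s, w))) := by
    simp only [intervalIntegral.integral_same, neg_zero, Real.exp_zero, mul_one, hY0] at hconst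
    rw [← hconst, mul_assoc, ← Real.exp_add]
    simp
  refine ⟨main, ?_⟩
  rw [main]
  exact mul_neg_of_neg_of_pos (neg_neg_of_pos (hH2 _)) (Real.exp_pos _)
end

section
/- Let h ∈ ℝ, let H̲ > 0, and let H = (H₁,H₂) : ℝ² → ℝ² be a Lipschitz continuous vector field with H₂(x) ≥ H̲ for all x ∈ ℝ². Suppose X : ℝ × ℝ → ℝ² satisfies, for every w ∈ ℝ, X(0,w) = (w,h) and ∂X/∂t(t,w) = H(X(t,w)) for all t ∈ ℝ. Then the map (t,w) ↦ X(t,w) is injective: if X(t₁,w₁) = X(t₂,w₂) then t₁ = t₂ and w₁ = w₂ (injectivity part of Proposition 1.2 i). -/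
/-- **Injectivity part of Proposition 1.2 i)**: the flow map `(t,w) ↦ X(t,w)` of a
Lipschitz vector field `H` with second component `H₂ ≥ Hlow > 0`, starting on the line
`x₂ = h`, is injective. -/
theorem flow_injective (h Hlow : ℝ) (hHlow : 0 < Hlow) (K : NNReal)
    (H : ℝ × ℝ → ℝ × ℝ) (hHlip : LipschitzWith K H)
    (hH2 : ∀ x : ℝ × ℝ, Hlow ≤ (H x).2)
    (X : ℝ × ℝ → ℝ × ℝ)
    (hX0 : ∀ w : ℝ, X (0, w) = (w, h))
    (hflow : ∀ t w : ℝ, HasDerivAt (fun s => X (s, w)) (H (X (t, w))) t) :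
    ∀ t₁ w₁ t₂ w₂ : ℝ, X (t₁, w₁) = X (t₂, w₂) → t₁ = t₂ ∧ w₁ = w₂ := by
  intro t₁ w₁ t₂ w₂ heq
  have hfg : (fun s => X (s, w₁)) = fun s => X (s + (t₂ - t₁), w₂) := by
    refine ODE_solution_unique_univ (v := fun _ => H) (s := fun _ => Set.univ) (K := K)
      (t₀ := t₁) (fun _ => hHlip.lipschitzOnWith) (fun t => ⟨hflow t w₁, trivial⟩)
      (fun t => ⟨?_, trivial⟩) ?_
    · exact (hflow (t + (t₂ - t₁)) w₂).comp_add_const t (t₂ - t₁)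
    · simpa using heq
  have h0 : X (0, w₁) = X (t₂ - t₁, w₂) := by
    simpa using congrFun hfg 0
  have hd : ∀ t, HasDerivAt (fun s => (X (s, w₂)).2) (H (X (t, w₂))).2 t := by
    intro t
    have h1 := (ContinuousLinearMap.snd ℝ ℝ ℝ).hasFDerivAt.comp_hasDerivAt t (hflow t w₂)
    exact h1
  have hmono : StrictMono (fun s => (X (s, w₂)).2) := by
    apply strictMono_of_deriv_pos
    intro t
    rw [(hd t).deriv]
    exact lt_of_lt_of_le hHlow (hH2 _)
  have hz : t₂ - t₁ = 0 := by
    apply hmono.injective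
    show (X (t₂ - t₁, w₂)).2 = (X (0, w₂)).2
    rw [← h0, hX0, hX0]
  rw [hz, hX0, hX0] at h0
  exact ⟨by linarith, congrArg Prod.fst h0⟩
end

section
/- Let Ω ⊂ ℝ² be a nonempty bounded open set, set M = sup{x₂ : (x₁,x₂) ∈ Ω}, let H̲ > 0, and let H = (H₁,H₂) : ℝ² → ℝ² be continuous with H₂(x) ≥ H̲ for all x ∈ ℝ². Let (w,h) ∈ Ω and let X = (X₁,X₂) : [0,∞) → ℝ² satisfy X(0) = (w,h) and X'(t) = H(X(t)) for all t ≥ 0. Define the exit time α₊ = sup{t ≥ 0 : X(s) ∈ Ω for all s ∈ [0,t)}. Then: (a) X₂(t) ≥ h + H̲·t for all t ≥ 0; (b) 0 < α₊ ≤ (M − h)/H̲; (c) X(α₊) ∈ ∂Ω; and (d) X₂(α₊) > h, i.e. the orbit exits Ω in finite positive time through a boundary point lying strictly above the line x₂ = h. -/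
/-- **Exit of the orbit through the upper boundary** (part of Section 1):
an orbit of `X' = H(X)` with `H₂ ≥ Hlow > 0` starting at `(w,h) ∈ Ω` satisfies
`X₂(t) ≥ h + Hlow·t`, leaves the bounded open set `Ω` at a finite positive exit time
`α₊ ≤ (M−h)/Hlow`, and exits through a boundary point lying strictly above `x₂ = h`. -/
theorem orbit_exit (Ω : Set (ℝ × ℝ)) (hΩne : Ω.Nonempty)
    (hΩb : Bornology.IsBounded Ω) (hΩo : IsOpen Ω)
    (M Hlow : ℝ) (hM : M = sSup (Prod.snd '' Ω)) (hHlow : 0 < Hlow)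
    (H : ℝ × ℝ → ℝ × ℝ) (hHc : Continuous H) (hH2 : ∀ x : ℝ × ℝ, Hlow ≤ (H x).2)
    (w h : ℝ) (hwh : (w, h) ∈ Ω)
    (X : ℝ → ℝ × ℝ) (hX0 : X 0 = (w, h))
    (hflow : ∀ t : ℝ, 0 ≤ t → HasDerivWithinAt X (H (X t)) (Set.Ici 0) t)
    (α : ℝ) (hα : α = sSup {t : ℝ | 0 ≤ t ∧ ∀ s ∈ Set.Ico 0 t, X s ∈ Ω}) :
    (∀ t : ℝ, 0 ≤ t → h + Hlow * t ≤ (X t).2) ∧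
    (0 < α ∧ α ≤ (M - h) / Hlow) ∧
    X α ∈ frontier Ω ∧
    h < (X α).2 := by
  have hcont : ContinuousOn X (Set.Ici 0) := fun t ht => (hflow t ht).continuousWithinAt
  have hd2 : ∀ t : ℝ, 0 ≤ t →
      HasDerivWithinAt (fun s => (X s).2 - Hlow * s) ((H (X t)).2 - Hlow) (Set.Ici 0) t := by
    intro t ht
    have h1 : HasDerivWithinAt (fun s => (X s).2) (H (X t)).2 (Set.Ici 0) t :=
      (hasFDerivAt_snd (𝕜 := ℝ) (p := X t)).comp_hasDerivWithinAt t (hflow t ht)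
    have h2 : HasDerivWithinAt (fun s : ℝ => Hlow * s) Hlow (Set.Ici 0) t := by
      simpa using (hasDerivWithinAt_id t (Set.Ici 0)).const_mul Hlow
    exact h1.sub h2
  have hmono : MonotoneOn (fun s => (X s).2 - Hlow * s) (Set.Ici 0) := by
    refine monotoneOn_of_hasDerivWithinAt_nonneg (f' := fun t => (H (X t)).2 - Hlow)
      (convex_Ici 0) (fun t ht => (hd2 t ht).continuousWithinAt) ?_ ?_
    · intro t ht
      exact (hd2 t (interior_subset ht)).mono interior_subset
    · intro t _
      exact sub_nonneg.2 (hH2 _)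
  have ha : ∀ t : ℝ, 0 ≤ t → h + Hlow * t ≤ (X t).2 := by
    intro t ht
    have := hmono (Set.mem_Ici.2 le_rfl) (Set.mem_Ici.2 ht) ht
    simp [hX0] at this
    linarith
  have hbdd : BddAbove (Prod.snd '' Ω) := hΩb.image_snd.bddAbove
  have hle : ∀ x ∈ Ω, x.2 ≤ M := fun x hx => hM ▸ le_csSup hbdd ⟨x, hx, rfl⟩
  set S := {t : ℝ | 0 ≤ t ∧ ∀ s ∈ Set.Ico 0 t, X s ∈ Ω} with hS
  have hB0 : 0 ≤ (M - h) / Hlow := div_nonneg (sub_nonneg.2 (hle _ hwh)) hHlow.le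
  have hSB : ∀ t ∈ S, t ≤ (M - h) / Hlow := by
    rintro t ⟨_, ht⟩
    refine le_of_forall_lt_imp_le_of_dense fun s hs => ?_
    rcases le_or_gt 0 s with h0 | h0
    · rw [le_div_iff₀ hHlow]
      have h1 := hle _ (ht s ⟨h0, hs⟩)
      have h2 := ha s h0
      linarith
    · linarith
  have hSbdd : BddAbove S := ⟨_, hSB⟩
  have hS0 : (0:ℝ) ∈ S := ⟨le_rfl, fun s hs => absurd hs.2 (not_lt.2 hs.1)⟩
  have hin : ∀ s, 0 ≤ s → s < α → X s ∈ Ω := by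
    intro s h0 hs
    rw [hα] at hs
    obtain ⟨t, ht, hst⟩ := exists_lt_of_lt_csSup ⟨0, hS0⟩ hs
    exact ht.2 s ⟨h0, hst⟩
  have hα0 : 0 ≤ α := hα ▸ le_csSup hSbdd hS0
  have hnot : X α ∉ Ω := by
    intro hmem
    have h1 := (hcont α hα0).eventually (hΩo.mem_nhds hmem)
    obtain ⟨ε, hε, hball⟩ := Metric.mem_nhdsWithin_iff.1 h1
    have : α + ε ∈ S := by
      refine ⟨by linarith, fun s hs => ?_⟩
      rcases lt_or_ge s α with h2 | h2
      · exact hin s hs.1 h2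
      · refine hball ⟨?_, hs.1⟩
        rw [Metric.mem_ball, Real.dist_eq, abs_lt]
        constructor <;> linarith [hs.2]
    have := le_csSup hSbdd this
    rw [← hα] at this
    linarith
  have hαpos : 0 < α := by
    refine lt_of_le_of_ne hα0 fun h0 => hnot ?_
    rw [← h0, hX0]
    exact hwh
  refine ⟨ha, ⟨hαpos, hα ▸ csSup_le ⟨0, hS0⟩ hSB⟩, ?_, ?_⟩
  · rw [hΩo.frontier_eq]
    refine ⟨?_, hnot⟩
    have hc : ContinuousWithinAt X (Set.Ico 0 α) α :=
      (hcont α hα0).mono Set.Ico_subset_Ici_self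
    refine hc.mem_closure ?_ (fun s hs => hin s hs.1 hs.2)
    rw [closure_Ico hαpos.ne]
    exact ⟨hα0, le_rfl⟩
  · have := ha α hα0
    have := mul_pos hHlow hαpos
    linarith
end

section
/- Let Ω ⊂ ℝ² be a nonempty bounded open set, h ∈ ℝ, H̲ > 0, and let H : ℝ² → ℝ² be continuously differentiable with second component H₂(x) ≥ H̲ for all x ∈ ℝ². Let X : ℝ × ℝ → ℝ² be continuously differentiable with X(0,w) = (w,h) and ∂X/∂t(t,w) = H(X(t,w)) for all (t,w). Fix w₀ with (w₀,h) ∈ Ω, define α₊(w) = sup{t ≥ 0 : X(s,w) ∈ Ω for all s ∈ [0,t)} for w with (w,h) ∈ Ω, and set x₀ = X(α₊(w₀),w₀). Assume there exist an open set U ⊂ ℝ² containing x₀ and a continuously differentiable function Υ₂ : U → ℝ such that Ω ∩ U = {x ∈ U : Υ₂(x) > 0}, ∂Ω ∩ U = {x ∈ U : Υ₂(x) = 0}, and ∇Υ₂(x₀)·H(x₀) ≠ 0. Then α₊ is continuously differentiable on a neighborhood of w₀ (Theorem 1.1). -/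
open Filter Topology Set

/-- **Theorem 1.1**: the exit time `α₊` of the flow of `H` from `Ω` is continuously
differentiable near `w₀` when the boundary is a `C¹` level set `{Υ₂ = 0}` near the exit
point `x₀ = X(α₊(w₀), w₀)` and `H` is transversal to it there (`∇Υ₂(x₀)·H(x₀) ≠ 0`). -/
theorem exit_time_contDiff (Ω : Set (ℝ × ℝ)) (hΩne : Ω.Nonempty)
    (hΩb : Bornology.IsBounded Ω) (hΩo : IsOpen Ω)
    (h Hlow : ℝ) (hHlow : 0 < Hlow)
    (H : ℝ × ℝ → ℝ × ℝ) (hH : ContDiff ℝ 1 H) (hH2 : ∀ x : ℝ × ℝ, Hlow ≤ (H x).2)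
    (X : ℝ × ℝ → ℝ × ℝ) (hXc : ContDiff ℝ 1 X)
    (hX0 : ∀ w : ℝ, X (0, w) = (w, h))
    (hflow : ∀ t w : ℝ, HasDerivAt (fun s => X (s, w)) (H (X (t, w))) t)
    (w₀ : ℝ) (hw₀ : (w₀, h) ∈ Ω)
    (α : ℝ → ℝ)
    (hα : ∀ w : ℝ, α w = sSup {t : ℝ | 0 ≤ t ∧ ∀ s ∈ Set.Ico 0 t, X (s, w) ∈ Ω})
    (x₀ : ℝ × ℝ) (hx₀ : x₀ = X (α w₀, w₀))
    (U : Set (ℝ × ℝ)) (hU : IsOpen U) (hx₀U : x₀ ∈ U)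
    (Υ₂ : ℝ × ℝ → ℝ) (hΥ : ContDiffOn ℝ 1 Υ₂ U)
    (hΩU : Ω ∩ U = {x ∈ U | 0 < Υ₂ x})
    (hbdU : frontier Ω ∩ U = {x ∈ U | Υ₂ x = 0})
    (htrans : fderiv ℝ Υ₂ x₀ (H x₀) ≠ 0) :
    ∃ ε > 0, ContDiffOn ℝ 1 α (Metric.ball w₀ ε) := by
  have hXcont : Continuous X := hXc.continuous
  have hXt : ∀ w, Continuous (fun t : ℝ => X (t, w)) := fun w => by fun_prop
  set T := α w₀ with hT
  set S : Set ℝ := {t : ℝ | 0 ≤ t ∧ ∀ s ∈ Set.Ico 0 t, X (s, w₀) ∈ Ω} with hS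
  have hTS : T = sSup S := hα w₀
  have hgrow : ∀ t, 0 ≤ t → h + Hlow * t ≤ (X (t, w₀)).2 := by
    intro t ht
    have hd : ∀ s, HasDerivAt (fun s => (X (s, w₀)).2 - Hlow * s) ((H (X (s, w₀))).2 - Hlow) s := by
      intro s
      have h1 : HasDerivAt (fun s => (X (s, w₀)).2) (H (X (s, w₀))).2 s :=
        (ContinuousLinearMap.snd ℝ ℝ ℝ).hasFDerivAt.comp_hasDerivAt s (hflow s w₀)
      have h2 : HasDerivAt (fun s => Hlow * s) Hlow s := by
        simpa using (hasDerivAt_id s).const_mul Hlow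
      exact HasDerivAt.sub h1 h2
    have hm : Monotone (fun s => (X (s, w₀)).2 - Hlow * s) := by
      apply monotone_of_deriv_nonneg (fun s => (hd s).differentiableAt)
      intro s
      rw [(hd s).deriv]
      linarith [hH2 (X (s, w₀))]
    have := hm ht
    simp only [hX0] at this
    linarith
  have hbdd : BddAbove S := by
    obtain ⟨R, hR⟩ := hΩb.exists_norm_le
    refine ⟨(R - h) / Hlow + 1, fun t ht => ?_⟩
    by_contra hlt
    push Not at hlt
    set s := max 0 (t - 1 / 2) with hs
    rcases lt_or_ge 0 t with h0 | h0
    · have hst : s < t := by simp [hs, h0]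
      have hs0 : 0 ≤ s := le_max_left _ _
      have h1 := hR _ (ht.2 s ⟨hs0, hst⟩)
      have h2 := hgrow s hs0
      have h3 : (X (s, w₀)).2 ≤ R := (le_abs_self _).trans ((norm_snd_le _).trans h1)
      have h4 : (R - h) / Hlow < s := by
        have : t - 1/2 ≤ s := le_max_right _ _
        linarith
      rw [div_lt_iff₀ hHlow] at h4
      nlinarith
    · have h1 := hR _ hw₀
      have h3 : h ≤ R := (le_abs_self _).trans ((norm_snd_le ((w₀, h) : ℝ × ℝ)).trans h1)
      have : 0 ≤ (R - h) / Hlow := div_nonneg (by linarith) hHlow.le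
      linarith
  have h0S : (0 : ℝ) ∈ S := ⟨le_rfl, fun s hs => absurd hs.2 (not_lt.2 hs.1)⟩
  have hT0 : 0 ≤ T := hTS ▸ le_csSup hbdd h0S
  have hin : ∀ s, 0 ≤ s → s < T → X (s, w₀) ∈ Ω := by
    intro s hs hsT
    rw [hTS] at hsT
    obtain ⟨t, ht, hst⟩ := exists_lt_of_lt_csSup ⟨0, h0S⟩ hsT
    exact ht.2 s ⟨hs, hst⟩
  have hx₀Ω : x₀ ∉ Ω := by
    intro hx
    rw [hx₀] at hx
    have hev : ∀ᶠ t in 𝓝 T, X (t, w₀) ∈ Ω := (hXt w₀).continuousAt.eventually (hΩo.mem_nhds hx)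
    obtain ⟨δ, hδ, hb⟩ := Metric.eventually_nhds_iff.1 hev
    have : T + δ / 2 ∈ S := by
      refine ⟨by linarith, fun s hs => ?_⟩
      rcases lt_or_ge s T with hsT | hsT
      · exact hin s hs.1 hsT
      · apply hb
        rw [Real.dist_eq, abs_lt]
        constructor <;> linarith [hs.2]
    have := le_csSup hbdd this
    linarith
  have hTpos : 0 < T := by
    rcases hT0.lt_or_eq with h1 | h1
    · exact h1
    · exfalso
      apply hx₀Ω
      rw [hx₀, ← h1, hX0]
      exact hw₀
  have hfr : x₀ ∈ frontier Ω := by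
    rw [hΩo.frontier_eq]
    refine ⟨?_, hx₀Ω⟩
    rw [hx₀]
    have ht : Tendsto (fun t => X (t, w₀)) (𝓝[<] T) (𝓝 (X (T, w₀))) :=
      (hXt w₀).continuousAt.tendsto.mono_left nhdsWithin_le_nhds
    apply mem_closure_of_tendsto ht
    filter_upwards [Ioo_mem_nhdsLT hTpos] with t ht
    exact hin t ht.1.le ht.2
  have hΥ0 : Υ₂ x₀ = 0 := by
    have : x₀ ∈ frontier Ω ∩ U := ⟨hfr, hx₀U⟩
    rw [hbdU] at this
    exact this.2
  set f : ℝ × ℝ → ℝ := fun p => Υ₂ (X (p.2, p.1)) with hf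
  have hΥat : ContDiffAt ℝ 1 Υ₂ (X (T, w₀)) := hx₀ ▸ hΥ.contDiffAt (hU.mem_nhds hx₀U)
  have cdf : ContDiffAt ℝ 1 f (w₀, T) := by
    have : ContDiffAt ℝ 1 (fun p : ℝ × ℝ => X (p.2, p.1)) (w₀, T) :=
      (hXc.comp (contDiff_snd.prodMk contDiff_fst)).contDiffAt
    exact ContDiffAt.comp (w₀, T) (g := Υ₂) (f := fun p : ℝ × ℝ => X (p.2, p.1)) hΥat this
  have hfd : fderiv ℝ f (w₀, T) (0, 1) = fderiv ℝ Υ₂ x₀ (H x₀) := by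
    have h1 : HasFDerivAt Υ₂ (fderiv ℝ Υ₂ x₀) (X (T, w₀)) := by
      rw [hx₀]; exact (hΥat.differentiableAt one_ne_zero).hasFDerivAt
    have h2 : HasDerivAt (fun t => f (w₀, t)) (fderiv ℝ Υ₂ x₀ (H (X (T, w₀)))) T :=
      h1.comp_hasDerivAt T (hflow T w₀)
    have h3 : HasFDerivAt f (fderiv ℝ f (w₀, T)) (w₀, T) :=
      (cdf.differentiableAt one_ne_zero).hasFDerivAt
    have h4 : HasDerivAt (fun t => f (w₀, t)) (fderiv ℝ f (w₀, T) (0, 1)) T :=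
      h3.comp_hasDerivAt T ((hasDerivAt_const T w₀).prodMk (hasDerivAt_id T))
    rw [h4.unique h2, hx₀]
  have hinv : (fderiv ℝ f (w₀, T) ∘L .inr ℝ ℝ ℝ).IsInvertible := by
    refine ⟨ContinuousLinearEquiv.unitsEquivAut ℝ (Units.mk0 _ htrans), ?_⟩
    ext
    simp [hfd]
  set ψ := cdf.implicitFunction one_ne_zero hinv with hψ
  have hψC : ContDiffAt ℝ 1 ψ w₀ := cdf.contDiffAt_implicitFunction one_ne_zero hinv
  have hψ0 : ψ w₀ = T := cdf.implicitFunction_apply_self one_ne_zero hinv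
  have hiff : ∀ᶠ v in 𝓝 (w₀, T), f v = f (w₀, T) ↔ ψ v.1 = v.2 :=
    cdf.eventually_apply_eq_iff_implicitFunction one_ne_zero hinv
  have hf0 : f (w₀, T) = 0 := by simp only [hf]; rw [← hx₀, hΥ0]
  have hUev : ∀ᶠ v : ℝ × ℝ in 𝓝 (w₀, T), X (v.2, v.1) ∈ U := by
    have hc : Continuous (fun v : ℝ × ℝ => X (v.2, v.1)) := by fun_prop
    exact hc.continuousAt.eventually (hU.mem_nhds (by simpa [← hx₀] using hx₀U))
  obtain ⟨δ₀, hδ₀, hb⟩ := Metric.eventually_nhds_iff.1 (hiff.and hUev)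
  obtain ⟨δ, hδ, hδ1, hδ2⟩ : ∃ δ > 0, δ < δ₀ ∧ δ < T :=
    ⟨min δ₀ T / 2, by positivity, by linarith [min_le_left δ₀ T, lt_min hδ₀ hTpos],
      by linarith [min_le_right δ₀ T, lt_min hδ₀ hTpos]⟩
  have hcomp : ∀ᶠ w in 𝓝 w₀, ∀ s ∈ Icc 0 (T - δ), X (s, w) ∈ Ω := by
    apply isCompact_Icc.eventually_forall_of_forall_eventually
    intro s hs
    have hc : Continuous (fun v : ℝ × ℝ => X (v.2, v.1)) := by fun_prop
    exact hc.continuousAt.eventually (hΩo.mem_nhds (hin s hs.1 (by linarith [hs.2])))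
  have hψev : ∀ᶠ w in 𝓝 w₀, ψ w ∈ Ioo (T - δ) (T + δ) :=
    hψC.continuousAt.eventually (by rw [hψ0]; exact Ioo_mem_nhds (by linarith) (by linarith))
  have heq : α =ᶠ[𝓝 w₀] ψ := by
    filter_upwards [hcomp, hψev, Metric.ball_mem_nhds w₀ hδ₀] with w hw1 hw2 hw3
    have key : ∀ t ∈ Icc (T - δ) (T + δ), (f (w, t) = 0 ↔ ψ w = t) ∧ X (t, w) ∈ U := by
      intro t ht
      have : dist (w, t) (w₀, T) < δ₀ := by
        rw [Prod.dist_eq, max_lt_iff]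
        refine ⟨hw3, ?_⟩
        rw [Real.dist_eq, abs_lt]
        constructor <;> linarith [ht.1, ht.2]
      have := hb this
      rw [hf0] at this
      exact this
    have hout : X (ψ w, w) ∉ Ω := by
      have hk := key (ψ w) ⟨hw2.1.le, hw2.2.le⟩
      have h1 : f (w, ψ w) = 0 := hk.1.2 rfl
      intro hmem
      have : X (ψ w, w) ∈ Ω ∩ U := ⟨hmem, hk.2⟩
      rw [hΩU] at this
      exact absurd h1 this.2.ne'
    rw [hα w]
    apply IsGreatest.csSup_eq
    refine ⟨⟨by linarith [hw2.1], fun s hs => ?_⟩, fun t ht => ?_⟩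
    · rcases le_or_gt s (T - δ) with h1 | h1
      · exact hw1 s ⟨hs.1, h1⟩
      have hsub : Icc (T - δ) s ⊆ Icc (T - δ) (T + δ) :=
        Icc_subset_Icc_right (by linarith [hs.2, hw2.2])
      have hpos0 : 0 < f (w, T - δ) := by
        have : X (T - δ, w) ∈ Ω ∩ U :=
          ⟨hw1 _ ⟨by linarith, le_rfl⟩, (key (T - δ) ⟨le_rfl, by linarith⟩).2⟩
        rw [hΩU] at this
        exact this.2
      have hcont : ContinuousOn (fun t => f (w, t)) (Icc (T - δ) s) :=
        hΥ.continuousOn.comp (hXt w).continuousOn (fun t ht => (key t (hsub ht)).2)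
      have hpos : 0 < f (w, s) := by
        by_contra hneg
        push Not at hneg
        obtain ⟨c, hc, hc0⟩ := intermediate_value_Icc' h1.le hcont ⟨hneg, hpos0.le⟩
        have := (key c (hsub hc)).1.1 hc0
        linarith [hc.2, hs.2]
      have : X (s, w) ∈ {x ∈ U | 0 < Υ₂ x} := ⟨(key s (hsub ⟨h1.le, le_rfl⟩)).2, hpos⟩
      rw [← hΩU] at this
      exact this.1
    · by_contra hlt
      push Not at hlt
      exact hout (ht.2 _ ⟨by linarith [hw2.1], hlt⟩)
  have hαC : ContDiffAt ℝ 1 α w₀ := hψC.congr_of_eventuallyEq heq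
  obtain ⟨ε, hε, hball⟩ := Metric.eventually_nhds_iff.1 (hαC.eventually (by simp))
  exact ⟨ε, hε, fun w hw => (hball hw).contDiffWithinAt⟩
end

section
/- Let G ⊂ ℝ × ℝ be a set with the following property: for every (t₀,w₀) ∈ G there exists ε > 0 such that {(t,w) ∈ ℝ × ℝ : |w − w₀| < ε and t < t₀ + ε} ⊂ G. Define Φ : ℝ → [−∞,+∞] by Φ(w) = sup{t ∈ ℝ : (t,w) ∈ G} (with sup ∅ = −∞). Then Φ is lower semicontinuous on ℝ, and G = {(t,w) ∈ ℝ × ℝ : t < Φ(w)} (the abstract content of Proposition 2.3: the positivity set of u is the strict subgraph of a lower semicontinuous function Φ_h). -/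
/-- **Abstract content of Proposition 2.3**: if `G ⊂ ℝ × ℝ` has the cone property that
every `(t₀,w₀) ∈ G` admits `ε > 0` with `{|w − w₀| < ε, t < t₀ + ε} ⊂ G`, then
`Φ(w) = sup {t : (t,w) ∈ G}` (an extended-real-valued sup, with `sup ∅ = −∞`) is lower
semicontinuous and `G = {(t,w) : t < Φ(w)}`. -/
theorem subgraph_lsc (G : Set (ℝ × ℝ))
    (hG : ∀ p ∈ G, ∃ ε > 0, ∀ q : ℝ × ℝ, |q.2 - p.2| < ε → q.1 < p.1 + ε → q ∈ G)
    (Φ : ℝ → EReal)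
    (hΦ : ∀ w : ℝ, Φ w = sSup ((fun t : ℝ => (t : EReal)) '' {t : ℝ | (t, w) ∈ G})) :
    LowerSemicontinuous Φ ∧ G = {p : ℝ × ℝ | (p.1 : EReal) < Φ p.2} := by
  constructor
  · intro w c hc
    rw [gt_iff_lt, hΦ, lt_sSup_iff] at hc
    obtain ⟨_, ⟨t, ht, rfl⟩, hct⟩ := hc
    obtain ⟨ε, hε, h⟩ := hG _ ht
    filter_upwards [Metric.ball_mem_nhds w hε] with v hv
    show c < Φ v
    rw [hΦ, lt_sSup_iff]
    refine ⟨_, ⟨t, h (t, v) ?_ ?_, rfl⟩, hct⟩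
    · simpa [Real.dist_eq] using hv
    · simpa using hε
  · ext ⟨t, w⟩
    simp only [Set.mem_ofPred_eq]
    rw [hΦ, lt_sSup_iff]
    constructor
    · intro ht
      obtain ⟨ε, hε, h⟩ := hG _ ht
      refine ⟨_, ⟨t + ε / 2, h (t + ε / 2, w) ?_ ?_, rfl⟩, ?_⟩
      · simpa using hε
      · simp only
        linarith
      · simp only [EReal.coe_lt_coe_iff]
        linarith
    · rintro ⟨_, ⟨s, hs, rfl⟩, hts⟩
      obtain ⟨ε, hε, h⟩ := hG _ hs
      simp only [EReal.coe_lt_coe_iff] at hts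
      refine h (t, w) ?_ ?_
      · simpa using hε
      · simp only
        linarith
end
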